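/- arXiv:2502.04683 — 2 statements merged into one kernel-verified Lean document; each statement's English description precedes it below -/
import Mathlib

section
/- Let C be an additive category and let X, Y be objects of C with add X = add Y, i.e. each of X and Y is a direct summand of a finite direct sum of copies of the other. Then the endomorphism rings End_C(X) and End_C(Y) are Morita equivalent. -/
/-!
STATEMENT 1: If `C` is an additive category and `X, Y` are objects with
`add X = add Y` (each is a direct summand of a finite direct sum of copies of
the other), then `End X` and `End Y` are Morita equivalent rings.
-/

open CategoryTheory CategoryTheory.Limits

universe v u

/-- Morita equivalence of two rings: their module categories are equivalent. -/
def IsMoritaEquivalentRing (R : Type u) (S : Type v) [Ring R] [Ring S] : Prop :=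
  Nonempty (ModuleCat.{max u v} R ≌ ModuleCat.{max u v} S)

namespace MoritaAux

variable {C : Type u} [Category.{v} C] [Preadditive C]

/-- The `End X`-linear maps `Hom(Y, X) → M`, regarded as an `End Y`-module. -/
def HomMod (X Y : C) (M : Type v) [AddCommGroup M] [Module (End X) M] : Type v :=
  (Y ⟶ X) →ₗ[End X] M

section

variable (X Y : C) (M : Type v) [AddCommGroup M] [Module (End X) M]

instance : AddCommGroup (HomMod X Y M) :=
  inferInstanceAs (AddCommGroup ((Y ⟶ X) →ₗ[End X] M))

instance : FunLike (HomMod X Y M) (Y ⟶ X) M :=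
  inferInstanceAs (FunLike ((Y ⟶ X) →ₗ[End X] M) (Y ⟶ X) M)

variable {X Y M}

theorem HomMod.ext {φ ψ : HomMod X Y M} (h : ∀ b, φ b = ψ b) : φ = ψ :=
  DFunLike.ext _ _ h

theorem HomMod.add_apply (φ ψ : HomMod X Y M) (b : Y ⟶ X) : (φ + ψ) b = φ b + ψ b := rfl

theorem HomMod.zero_apply (b : Y ⟶ X) : (0 : HomMod X Y M) b = 0 := rfl

theorem HomMod.map_add (φ : HomMod X Y M) (b c : Y ⟶ X) : φ (b + c) = φ b + φ c :=
  LinearMap.map_add (φ : (Y ⟶ X) →ₗ[End X] M) b c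

theorem HomMod.map_zero (φ : HomMod X Y M) : φ 0 = 0 :=
  LinearMap.map_zero (φ : (Y ⟶ X) →ₗ[End X] M)

theorem HomMod.map_sum (φ : HomMod X Y M) {ι : Type} (s : Finset ι) (b : ι → (Y ⟶ X)) :
    φ (∑ k ∈ s, b k) = ∑ k ∈ s, φ (b k) :=
  _root_.map_sum (show (Y ⟶ X) →ₗ[End X] M from φ) b s

theorem HomMod.sum_apply {ι : Type} (s : Finset ι) (φ : ι → HomMod X Y M) (b : Y ⟶ X) :
    (∑ k ∈ s, φ k) b = ∑ k ∈ s, φ k b :=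
  LinearMap.sum_apply s (fun k => (φ k : (Y ⟶ X) →ₗ[End X] M)) b

theorem HomMod.map_comp (φ : HomMod X Y M) (b : Y ⟶ X) (f : End X) :
    φ (b ≫ f) = f • φ b :=
  LinearMap.map_smul (φ : (Y ⟶ X) →ₗ[End X] M) f b

/-- Constructor for `HomMod`. -/
def HomMod.mk (φ : (Y ⟶ X) → M) (h₁ : ∀ b c, φ (b + c) = φ b + φ c)
    (h₂ : ∀ (b : Y ⟶ X) (f : End X), φ (b ≫ f) = f • φ b) : HomMod X Y M :=
  ({ toFun := φ, map_add' := h₁, map_smul' := fun f b => h₂ b f } : (Y ⟶ X) →ₗ[End X] M)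

theorem HomMod.mk_apply (φ : (Y ⟶ X) → M) (h₁ h₂) (b : Y ⟶ X) :
    (HomMod.mk φ h₁ h₂ : HomMod X Y M) b = φ b := rfl

instance : SMul (End Y) (HomMod X Y M) where
  smul g φ := HomMod.mk (fun b => φ ((show Y ⟶ Y from g) ≫ b))
    (fun b c => by rw [Preadditive.comp_add, HomMod.map_add])
    (fun b f => by rw [← Category.assoc, HomMod.map_comp])

theorem HomMod.smul_apply (g : End Y) (φ : HomMod X Y M) (b : Y ⟶ X) :
    (g • φ) b = φ ((show Y ⟶ Y from g) ≫ b) := rfl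

instance : Module (End Y) (HomMod X Y M) where
  one_smul φ := HomMod.ext fun b => congrArg φ (Category.id_comp b)
  mul_smul g g₂ φ := HomMod.ext fun b => congrArg φ (Category.assoc _ _ _)
  smul_zero g := rfl
  smul_add g φ ψ := rfl
  add_smul g g₂ φ := HomMod.ext fun b =>
    (congrArg φ (Preadditive.add_comp _ _ _ _ _ _)).trans (φ.map_add _ _)
  zero_smul φ := HomMod.ext fun b =>
    (congrArg φ Limits.zero_comp).trans φ.map_zero

/-- Functoriality of `HomMod`. -/
def HomMod.map {N : Type v} [AddCommGroup N] [Module (End X) N] (t : M →ₗ[End X] N) :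
    HomMod X Y M →ₗ[End Y] HomMod X Y N where
  toFun φ := HomMod.mk (fun b => t (φ b))
    (fun b c => by rw [HomMod.map_add, _root_.map_add])
    (fun b f => by rw [HomMod.map_comp, _root_.map_smul])
  map_add' φ ψ := HomMod.ext fun b => t.map_add _ _
  map_smul' g φ := rfl

end

/-- The functor `M ↦ Hom_{End X}(Hom(Y, X), M)`. -/
def homFunctor (X Y : C) : ModuleCat.{v} (End X) ⥤ ModuleCat.{v} (End Y) where
  obj M := ModuleCat.of (End Y) (HomMod X Y M)
  map t := ModuleCat.ofHom (HomMod.map t.hom)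
  map_id _ := rfl
  map_comp _ _ := rfl

/-- The unit map `m ↦ (a ↦ b ↦ (a ≫ b) • m)`. -/
def unitMap (X Y : C) (M : Type v) [AddCommGroup M] [Module (End X) M] :
    M →ₗ[End X] HomMod Y X (HomMod X Y M) where
  toFun m := HomMod.mk
    (fun a => HomMod.mk (fun b => (show End X from a ≫ b) • m)
      (fun b c => by
        rw [← add_smul]
        exact congrArg (fun f : End X => f • m) (Preadditive.comp_add _ _ _ _ _ _))
      (fun b f => by
        rw [← mul_smul]
        exact congrArg (fun f : End X => f • m) (Category.assoc _ _ _).symm))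
    (fun a a₂ => HomMod.ext fun b => by
      rw [HomMod.add_apply]
      simp only [HomMod.mk_apply]
      rw [← add_smul]
      exact congrArg (fun f : End X => f • m) (Preadditive.add_comp _ _ _ _ _ _))
    (fun a g => HomMod.ext fun b =>
      congrArg (fun f : End X => f • m) (Category.assoc _ _ _))
  map_add' m m₂ := HomMod.ext fun a => HomMod.ext fun b => smul_add _ _ _
  map_smul' f m := HomMod.ext fun a => HomMod.ext fun b => by
    change (show End X from a ≫ b) • f • m =
      (show End X from ((show X ⟶ X from f) ≫ a) ≫ b) • m
    rw [← mul_smul]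
    exact congrArg (fun f : End X => f • m) (Category.assoc _ _ _).symm

theorem unitMap_apply (X Y : C) (M : Type v) [AddCommGroup M] [Module (End X) M] (m : M)
    (a : X ⟶ Y) (b : Y ⟶ X) : unitMap X Y M m a b = (show End X from a ≫ b) • m := rfl

theorem unitMap_bijective (X Y : C) (M : Type v) [AddCommGroup M] [Module (End X) M]
    {n : ℕ} (a : Fin n → (X ⟶ Y)) (b : Fin n → (Y ⟶ X)) (h : ∑ k, a k ≫ b k = 𝟙 X) :
    Function.Bijective (unitMap X Y M) := by
  constructor
  · rw [injective_iff_map_eq_zero]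
    intro m hm
    have h1 : (∑ k, (show End X from a k ≫ b k)) • m = m :=
      (congrArg (fun f : End X => f • m) h).trans (one_smul _ m)
    rw [← h1, Finset.sum_smul]
    refine Finset.sum_eq_zero fun k _ => ?_
    rw [← unitMap_apply, hm]
    rfl
  · intro Φ
    refine ⟨∑ k, Φ (a k) (b k), HomMod.ext fun x => HomMod.ext fun y => ?_⟩
    rw [unitMap_apply, Finset.smul_sum]
    have key : ∀ k, (show End X from x ≫ y) • Φ (a k) (b k) = Φ ((a k ≫ b k) ≫ x) y := by
      intro k
      rw [← HomMod.map_comp, Category.assoc,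
        HomMod.map_comp Φ (a k) (show End Y from b k ≫ x), HomMod.smul_apply, Category.assoc]
    rw [Finset.sum_congr rfl fun k _ => key k, ← HomMod.sum_apply, ← HomMod.map_sum,
      ← Preadditive.sum_comp, h, Category.id_comp]

/-- The unit isomorphism. -/
noncomputable def unitIso (X Y : C) {n : ℕ} (a : Fin n → (X ⟶ Y)) (b : Fin n → (Y ⟶ X))
    (h : ∑ k, a k ≫ b k = 𝟙 X) :
    𝟭 (ModuleCat.{v} (End X)) ≅ homFunctor X Y ⋙ homFunctor Y X :=
  NatIso.ofComponents
    (fun M => (LinearEquiv.ofBijective (unitMap X Y M)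
      (unitMap_bijective X Y M a b h)).toModuleIso)
    (fun {M N} t => by
      ext m
      exact HomMod.ext fun x => HomMod.ext fun y =>
        (t.hom.map_smul (show End X from x ≫ y) m).symm)

theorem exists_sum [HasFiniteBiproducts C] {X Y : C}
    (h : ∃ (m : ℕ) (i : X ⟶ biproduct (fun _ : Fin m => Y))
      (p : biproduct (fun _ : Fin m => Y) ⟶ X), i ≫ p = 𝟙 X) :
    ∃ (n : ℕ) (a : Fin n → (X ⟶ Y)) (b : Fin n → (Y ⟶ X)), ∑ k, a k ≫ b k = 𝟙 X := by
  obtain ⟨m, i, p, hip⟩ := h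
  refine ⟨m, fun k => i ≫ biproduct.π _ k, fun k => biproduct.ι (fun _ : Fin m => Y) k ≫ p, ?_⟩
  calc _ = i ≫ (∑ k, biproduct.π (fun _ : Fin m => Y) k ≫ biproduct.ι (fun _ : Fin m => Y) k) ≫ p := by
        simp only [Preadditive.sum_comp, Preadditive.comp_sum, Category.assoc]
    _ = 𝟙 X := by rw [biproduct.total, Category.id_comp, hip]

end MoritaAux

theorem morita_of_add_eq_add
    {C : Type u} [Category.{v} C] [Preadditive C] [HasFiniteBiproducts C] (X Y : C)
    (h₁ : ∃ (m : ℕ) (i : X ⟶ biproduct (fun _ : Fin m => Y))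
      (p : biproduct (fun _ : Fin m => Y) ⟶ X), i ≫ p = 𝟙 X)
    (h₂ : ∃ (n : ℕ) (i : Y ⟶ biproduct (fun _ : Fin n => X))
      (p : biproduct (fun _ : Fin n => X) ⟶ Y), i ≫ p = 𝟙 Y) :
    IsMoritaEquivalentRing (End X) (End Y) := by
  obtain ⟨n, a, b, h⟩ := MoritaAux.exists_sum h₁
  obtain ⟨n₂, a₂, b₂, h₃⟩ := MoritaAux.exists_sum h₂
  exact ⟨CategoryTheory.Equivalence.mk (MoritaAux.homFunctor X Y) (MoritaAux.homFunctor Y X)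
    (MoritaAux.unitIso X Y a b h) (MoritaAux.unitIso Y X a₂ b₂ h₃).symm⟩
end

section
/- Let C be an additive category, F : C → C an additive endofunctor, and X, Y objects of C with add X = add Y, i.e. each of X and Y is a direct summand of a finite direct sum of copies of the other. Then the rings Ψ_F(X) and Ψ_F(Y) are Morita equivalent. -/
/-!
STATEMENT 4: Let `C` be an additive category, `F : C ⥤ C` an additive
endofunctor, and `X, Y` objects with `add X = add Y` (each is a direct summand
of a finite direct sum of copies of the other).  Then the `F`-preprojective
rings `Ψ_F(X) = ⊕_{i≥0} Hom(X, F^i X)` and `Ψ_F(Y)` are Morita equivalent.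
-/

open CategoryTheory CategoryTheory.Limits

universe v u u₁ u₂

/-- Morita equivalence of two rings: their module categories are equivalent. -/
def IsMoritaEquivalentRings (R : Type u₁) (S : Type u₂) [Ring R] [Ring S] : Prop :=
  Nonempty (ModuleCat.{max u₁ u₂} R ≌ ModuleCat.{max u₁ u₂} S)

namespace TotalPreprojective

variable {C : Type u} [Category.{v} C] [Preadditive C]

/-- The `n`-fold application of the endofunctor `F` to an object. -/
def pObj (F : C ⥤ C) : ℕ → C → C
  | 0, A => A
  | n + 1, A => F.obj (pObj F n A)

/-- The action of the `n`-fold iterate of `F` on morphisms. -/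
def pMap (F : C ⥤ C) : ∀ (n : ℕ) {A B : C}, (A ⟶ B) → (pObj F n A ⟶ pObj F n B)
  | 0, _, _, f => f
  | n + 1, _, _, f => F.map (pMap F n f)

variable (F : C ⥤ C)

lemma pObj_pObj (i j : ℕ) (A : C) : pObj F i (pObj F j A) = pObj F (j + i) A := by
  induction i with
  | zero => rfl
  | succ n ih => exact congrArg F.obj ih

lemma pMap_id (n : ℕ) (A : C) : pMap F n (𝟙 A) = 𝟙 (pObj F n A) := by
  induction n with
  | zero => rfl
  | succ n ih => show F.map _ = _; rw [ih, F.map_id]; rfl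

lemma pMap_comp (n : ℕ) {A B D : C} (f : A ⟶ B) (g : B ⟶ D) :
    pMap F n (f ≫ g) = pMap F n f ≫ pMap F n g := by
  induction n with
  | zero => rfl
  | succ n ih => show F.map _ = _; rw [ih, F.map_comp]; rfl

lemma pMap_eqToHom (n : ℕ) {A B : C} (h : A = B) :
    pMap F n (eqToHom h) = eqToHom (congrArg (pObj F n) h) := by
  subst h
  rw [eqToHom_refl, pMap_id]
  rfl

lemma pMap_pMap (j k : ℕ) {A B : C} (f : A ⟶ B) :
    pMap F k (pMap F j f) =
      eqToHom (pObj_pObj F k j A) ≫ pMap F (j + k) f ≫ eqToHom (pObj_pObj F k j B).symm := by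
  induction k with
  | zero =>
    show pMap F j f = 𝟙 (pObj F j A) ≫ pMap F j f ≫ 𝟙 (pObj F j B)
    rw [Category.id_comp, Category.comp_id]
  | succ k ih =>
    show F.map (pMap F k (pMap F j f)) = _
    rw [ih, F.map_comp, F.map_comp, eqToHom_map, eqToHom_map]
    rfl

end TotalPreprojective

namespace TotalPreprojective

variable {C : Type u} [Category.{v} C] [Preadditive C] (F : C ⥤ C)

section
variable [F.Additive]

lemma pMap_add (n : ℕ) {A B : C} (f g : A ⟶ B) :
    pMap F n (f + g) = pMap F n f + pMap F n g := by
  induction n with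
  | zero => rfl
  | succ n ih => show F.map _ = _; rw [ih, Functor.map_add]; rfl

lemma pMap_zero (n : ℕ) (A B : C) : pMap F n (0 : A ⟶ B) = 0 := by
  induction n with
  | zero => rfl
  | succ n ih => show F.map _ = _; rw [ih, Functor.map_zero]; rfl

end

variable (X : C)

instance psiGMul : GradedMonoid.GMul (fun i => (X ⟶ pObj F i X)) where
  mul {i j} a b := b ≫ pMap F j a ≫ eqToHom (pObj_pObj F j i X)

instance psiGOne : GradedMonoid.GOne (fun i => (X ⟶ pObj F i X)) where
  one := (𝟙 X : X ⟶ X)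

instance psiGMonoid : GradedMonoid.GMonoid (fun i => (X ⟶ pObj F i X)) where
  one_mul a := by
    obtain ⟨i, a⟩ := a
    refine Sigma.ext (zero_add i) ?_
    refine (conj_eqToHom_iff_heq _ _ rfl (congrArg (fun n => pObj F n X) (zero_add i))).mp ?_
    show a ≫ pMap F i (𝟙 X) ≫ eqToHom (pObj_pObj F i 0 X) = _
    simp only [pMap_id, eqToHom_refl, Category.id_comp]
  mul_one a := by
    obtain ⟨i, a⟩ := a
    refine Sigma.ext (add_zero i) ?_
    refine (conj_eqToHom_iff_heq _ _ rfl (congrArg (fun n => pObj F n X) (add_zero i))).mp ?_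
    show (𝟙 X) ≫ pMap F 0 a ≫ eqToHom (pObj_pObj F 0 i X) = _
    simp only [eqToHom_refl, Category.id_comp]
    rfl
  mul_assoc a b c := by
    obtain ⟨i, a⟩ := a
    obtain ⟨j, b⟩ := b
    obtain ⟨k, c⟩ := c
    refine Sigma.ext (add_assoc i j k) ?_
    refine (conj_eqToHom_iff_heq _ _ rfl
      (congrArg (fun n => pObj F n X) (add_assoc i j k))).mp ?_
    show c ≫ pMap F k (b ≫ pMap F j a ≫ eqToHom (pObj_pObj F j i X)) ≫
        eqToHom (pObj_pObj F k (i + j) X) =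
      eqToHom rfl ≫ ((c ≫ pMap F k b ≫ eqToHom (pObj_pObj F k j X)) ≫
        pMap F (j + k) a ≫ eqToHom (pObj_pObj F (j + k) i X)) ≫ eqToHom _
    rw [pMap_comp, pMap_comp, pMap_eqToHom, pMap_pMap]
    simp only [Category.assoc, eqToHom_trans, eqToHom_refl, Category.id_comp, Category.comp_id]

end TotalPreprojective

namespace TotalPreprojective

variable {C : Type u} [Category.{v} C] [Preadditive C] (F : C ⥤ C) [F.Additive] (X : C)

open DirectSum

instance psiGRing : DirectSum.GRing (fun i => (X ⟶ pObj F i X)) where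
  one_mul := (psiGMonoid F X).one_mul
  mul_one := (psiGMonoid F X).mul_one
  mul_assoc := (psiGMonoid F X).mul_assoc
  mul_zero {i j} a := by
    show (0 : X ⟶ pObj F j X) ≫ pMap F j a ≫ eqToHom (pObj_pObj F j i X) = 0
    simp
  zero_mul {i j} b := by
    show b ≫ pMap F j (0 : X ⟶ pObj F i X) ≫ eqToHom (pObj_pObj F j i X) = 0
    rw [pMap_zero]
    simp
  mul_add {i j} a b c := by
    show (b + c) ≫ pMap F j a ≫ eqToHom (pObj_pObj F j i X) = _
    rw [Preadditive.add_comp]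
    rfl
  add_mul {i j} a b c := by
    show c ≫ pMap F j (a + b) ≫ eqToHom (pObj_pObj F j i X) = _
    rw [pMap_add, Preadditive.add_comp, Preadditive.comp_add]
    rfl
  natCast n := n • (𝟙 X : X ⟶ pObj F 0 X)
  natCast_zero := by simp; rfl
  natCast_succ n := by
    show (n + 1) • (𝟙 X : X ⟶ pObj F 0 X) = n • (𝟙 X : X ⟶ pObj F 0 X) + (𝟙 X : X ⟶ pObj F 0 X)
    rw [succ_nsmul]
  intCast z := z • (𝟙 X : X ⟶ pObj F 0 X)
  intCast_ofNat n := by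
    show (n : ℤ) • (𝟙 X : X ⟶ pObj F 0 X) = n • (𝟙 X : X ⟶ pObj F 0 X)
    rw [natCast_zsmul]
  intCast_negSucc_ofNat n := by
    show (Int.negSucc n) • (𝟙 X : X ⟶ pObj F 0 X) = -((n + 1) • (𝟙 X : X ⟶ pObj F 0 X))
    rw [negSucc_zsmul]

/-- The total `F`-preprojective ring `Ψ_F(X) = ⊕_{i ≥ 0} Hom_C(X, F^i(X))`. -/
abbrev Psi (F : C ⥤ C) (X : C) : Type v := ⨁ i : ℕ, (X ⟶ pObj F i X)


end TotalPreprojective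

namespace TotalPreprojective

section Morita

variable {D : Type u} [Category.{v} D] [Preadditive D]

/-- `Hom_{End X}(Hom(Y, X), M)`. -/
abbrev HomMod (X Y : D) (M : Type v) [AddCommGroup M] [Module (End X) M] : Type v :=
  (Y ⟶ X) →ₗ[End X] M

/-- Precomposition as a linear map. -/
def precompLin (X : D) {Y Z : D} (s : Y ⟶ Z) : (Z ⟶ X) →ₗ[End X] (Y ⟶ X) where
  toFun h := s ≫ h
  map_add' _ _ := Preadditive.comp_add _ _ _ _ _ _
  map_smul' r h := (Category.assoc s h r).symm

/-- The left `End Y`-action on `Hom_{End X}(Hom(Y, X), M)`. -/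
instance homModModule (X Y : D) (M : Type v) [AddCommGroup M] [Module (End X) M] :
    Module (End Y) (HomMod X Y M) where
  smul s φ := φ.comp (precompLin X (s : Y ⟶ Y))
  one_smul φ := LinearMap.ext fun h => congrArg φ (Category.id_comp h)
  mul_smul s t φ := LinearMap.ext fun h => congrArg φ (Category.assoc _ _ _)
  smul_zero s := rfl
  smul_add s φ ψ := rfl
  add_smul s t φ := LinearMap.ext fun h =>
    (congrArg φ (Preadditive.add_comp _ _ _ _ _ _)).trans (map_add φ _ _)
  zero_smul φ := LinearMap.ext fun h => (congrArg φ zero_comp).trans (map_zero φ)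

lemma homMod_smul_apply (X Y : D) (M : Type v) [AddCommGroup M] [Module (End X) M]
    (s : End Y) (φ : HomMod X Y M) (h : Y ⟶ X) :
    (s • φ) h = φ ((show Y ⟶ Y from s) ≫ h) := rfl

/-- The functor `M ↦ Hom_{End X}(Hom(Y, X), M)`. -/
def homModFunctor (X Y : D) : ModuleCat.{v} (End X) ⥤ ModuleCat.{v} (End Y) where
  obj M := ModuleCat.of (End Y) (HomMod X Y M)
  map {M N} f := ModuleCat.ofHom
    { toFun := fun φ => f.hom.comp φ
      map_add' := fun φ ψ => LinearMap.ext fun h => map_add f.hom _ _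
      map_smul' := fun s φ => rfl }
  map_id _ := rfl
  map_comp _ _ := rfl

/-- The comparison map `M → Hom(Hom(X, Y), Hom(Hom(Y, X), M))`. -/
def biHom (X Y : D) (M : Type v) [AddCommGroup M] [Module (End X) M] :
    M →ₗ[End X] HomMod Y X (HomMod X Y M) where
  toFun m :=
    { toFun := fun q =>
        { toFun := fun p => (show End X from q ≫ p) • m
          map_add' := fun p p' => by
            rw [← add_smul]
            exact congrArg (fun r : End X => r • m) (Preadditive.comp_add _ _ _ _ _ _)
          map_smul' := fun r p => by
            rw [RingHom.id_apply, ← mul_smul]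
            exact congrArg (fun r : End X => r • m) (Category.assoc _ _ _).symm }
      map_add' := fun q q' => LinearMap.ext fun p => by
        refine Eq.trans ?_ (add_smul (show End X from q ≫ p) (show End X from q' ≫ p) m)
        exact congrArg (fun r : End X => r • m) (Preadditive.add_comp _ _ _ _ _ _)
      map_smul' := fun s q => LinearMap.ext fun p =>
        congrArg (fun r : End X => r • m) (Category.assoc _ _ _) }
  map_add' m m' := LinearMap.ext fun q => LinearMap.ext fun p => smul_add _ _ _
  map_smul' r m := LinearMap.ext fun q => LinearMap.ext fun p => by
    change (show End X from q ≫ p) • r • m = (show End X from (r ≫ q) ≫ p) • m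
    rw [← mul_smul]
    exact congrArg (fun r : End X => r • m) (Category.assoc _ _ _).symm

lemma biHom_apply (X Y : D) (M : Type v) [AddCommGroup M] [Module (End X) M] (m : M)
    (q : X ⟶ Y) (p : Y ⟶ X) : biHom X Y M m q p = (show End X from q ≫ p) • m := rfl

lemma biHom_bijective (X Y : D) {n : ℕ} (q : Fin n → (X ⟶ Y)) (p : Fin n → (Y ⟶ X))
    (h : ∑ k, q k ≫ p k = 𝟙 X) (M : Type v) [AddCommGroup M] [Module (End X) M] :
    Function.Bijective (biHom X Y M) := by
  have key : ∀ m : M, ∑ k, biHom X Y M m (q k) (p k) = m := fun m => by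
    simp only [biHom_apply]
    rw [← Finset.sum_smul]
    exact (congrArg (fun r : End X => r • m) h).trans (one_smul _ m)
  constructor
  · intro m m' hm
    rw [← key m, ← key m', hm]
  · intro Φ
    refine ⟨∑ k, Φ (q k) (p k), ?_⟩
    refine LinearMap.ext fun a => LinearMap.ext fun b => ?_
    rw [biHom_apply, Finset.smul_sum]
    have h1 : ∀ k, (show End X from a ≫ b) • Φ (q k) (p k) = Φ (q k ≫ p k ≫ a) b := fun k => by
      rw [← map_smul]
      have h2 : (show End Y from p k ≫ a) • Φ (q k) = Φ (q k ≫ p k ≫ a) :=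
        (Φ.map_smul (show End Y from p k ≫ a) (q k)).symm
      rw [← h2, homMod_smul_apply]
      exact congrArg (Φ (q k)) (Category.assoc _ _ _).symm
    rw [Finset.sum_congr rfl fun k _ => h1 k, ← LinearMap.sum_apply, ← map_sum]
    congr 2
    simp only [← Category.assoc]
    rw [← Preadditive.sum_comp, h, Category.id_comp]

/-- The comparison natural isomorphism. -/
noncomputable def biHomIso (X Y : D) {n : ℕ} (q : Fin n → (X ⟶ Y)) (p : Fin n → (Y ⟶ X))
    (h : ∑ k, q k ≫ p k = 𝟙 X) :
    𝟭 (ModuleCat.{v} (End X)) ≅ homModFunctor X Y ⋙ homModFunctor Y X :=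
  NatIso.ofComponents
    (fun M => (LinearEquiv.ofBijective (biHom X Y M) (biHom_bijective X Y q p h M)).toModuleIso)
    (fun {M N} f => by
      ext m
      refine LinearMap.ext fun a => LinearMap.ext fun b => ?_
      exact (map_smul f.hom _ _).symm)

/-- Objects of a preadditive category, each a summand of copies of the other, have
Morita equivalent endomorphism rings. -/
noncomputable def endMorita (X Y : D)
    {n : ℕ} (q : Fin n → (X ⟶ Y)) (p : Fin n → (Y ⟶ X)) (h : ∑ k, q k ≫ p k = 𝟙 X)
    {m : ℕ} (q' : Fin m → (Y ⟶ X)) (p' : Fin m → (X ⟶ Y)) (h' : ∑ k, q' k ≫ p' k = 𝟙 Y) :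
    ModuleCat.{v} (End X) ≌ ModuleCat.{v} (End Y) :=
  CategoryTheory.Equivalence.mk (homModFunctor X Y) (homModFunctor Y X)
    (biHomIso X Y q p h) (biHomIso Y X q' p' h').symm

end Morita

section Orbit

open DirectSum

variable {C : Type u} [Category.{v} C] [Preadditive C] (F : C ⥤ C) [F.Additive]

/-- Homogeneous composition in the orbit category. -/
def hComp {A B E : C} {i j : ℕ} (f : A ⟶ pObj F i B) (g : B ⟶ pObj F j E) :
    A ⟶ pObj F (j + i) E :=
  f ≫ pMap F i g ≫ eqToHom (pObj_pObj F i j E)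

/-- Homogeneous composition as a biadditive map. -/
def hCompHom (A B E : C) (i j : ℕ) :
    (A ⟶ pObj F i B) →+ (B ⟶ pObj F j E) →+ (A ⟶ pObj F (j + i) E) :=
  AddMonoidHom.mk' (fun f => AddMonoidHom.mk' (fun g => hComp F f g) fun g g' => by
      simp [hComp, pMap_add])
    fun f f' => by ext g; simp [hComp]

/-- Composition in the orbit category. -/
def oComp (A B E : C) : (⨁ i, (A ⟶ pObj F i B)) →+ (⨁ j, (B ⟶ pObj F j E)) →+
    ⨁ k, (A ⟶ pObj F k E) :=
  DirectSum.toAddMonoid fun i => AddMonoidHom.flip <| DirectSum.toAddMonoid fun j =>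
    AddMonoidHom.flip <|
      (DirectSum.of (fun k => (A ⟶ pObj F k E)) (j + i)).compHom.comp (hCompHom F A B E i j)

lemma oComp_of {A B E : C} {i j : ℕ} (f : A ⟶ pObj F i B) (g : B ⟶ pObj F j E) :
    oComp F A B E (of (fun i => (A ⟶ pObj F i B)) i f) (of (fun j => (B ⟶ pObj F j E)) j g) =
      of (fun k => (A ⟶ pObj F k E)) (j + i) (hComp F f g) := by
  simp [oComp, hCompHom]
  rfl

lemma of_congr {A B : C} {i j : ℕ} (h : i = j) (f : A ⟶ pObj F i B) (g : A ⟶ pObj F j B)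
    (hfg : f ≫ eqToHom (congrArg (fun n => pObj F n B) h) = g) :
    of (fun k => (A ⟶ pObj F k B)) i f = of (fun k => (A ⟶ pObj F k B)) j g := by
  subst h
  simp at hfg
  rw [hfg]

/-- The orbit category: same objects as `C`. -/
structure Orb (F : C ⥤ C) where
  /-- the underlying object -/
  as : C

/-- Identity in the orbit category. -/
def oId (A : C) : ⨁ i, (A ⟶ pObj F i A) := of (fun i => (A ⟶ pObj F i A)) 0 (𝟙 A)

lemma oId_comp {A B : C} (f : ⨁ i, (A ⟶ pObj F i B)) : oComp F A A B (oId F A) f = f := by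
  induction f using DirectSum.induction_on with
  | zero => simp
  | add f g hf hg => rw [map_add, hf, hg]
  | of i f =>
    refine (oComp_of F (i := 0) (𝟙 A) f).trans ?_
    refine of_congr F (add_zero i) _ _ ?_
    change (𝟙 A ≫ f ≫ 𝟙 (pObj F i B)) ≫ 𝟙 (pObj F i B) = f
    simp

lemma oComp_id {A B : C} (f : ⨁ i, (A ⟶ pObj F i B)) : oComp F A B B f (oId F B) = f := by
  induction f using DirectSum.induction_on with
  | zero => simp
  | add f g hf hg => rw [map_add, AddMonoidHom.add_apply, hf, hg]
  | of i f =>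
    refine (oComp_of F (j := 0) f (𝟙 B)).trans ?_
    refine of_congr F (zero_add i) _ _ ?_
    change (f ≫ pMap F i (𝟙 B) ≫ eqToHom _) ≫ _ = _
    rw [pMap_id]
    simp

lemma oComp_assoc {A B E G : C} (f : ⨁ i, (A ⟶ pObj F i B)) (g : ⨁ i, (B ⟶ pObj F i E))
    (h : ⨁ i, (E ⟶ pObj F i G)) :
    oComp F A E G (oComp F A B E f g) h = oComp F A B G f (oComp F B E G g h) := by
  induction f using DirectSum.induction_on with
  | zero => simp
  | add f f' hf hf' => simp only [map_add, AddMonoidHom.add_apply, hf, hf']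
  | of i f =>
    induction g using DirectSum.induction_on with
    | zero => simp
    | add f f' hf hf' => simp only [map_add, AddMonoidHom.add_apply, hf, hf']
    | of j g =>
      induction h using DirectSum.induction_on with
      | zero => simp
      | add f f' hf hf' => simp only [map_add, hf, hf']
      | of k h =>
        simp only [oComp_of]
        refine of_congr F (add_assoc k j i).symm _ _ ?_
        simp only [hComp]
        rw [pMap_comp, pMap_comp, pMap_eqToHom, pMap_pMap]
        simp only [Category.assoc, eqToHom_trans, eqToHom_refl, Category.id_comp,
          Category.comp_id, eqToHom_trans_assoc]

instance orbCategory : Category.{v} (Orb F) where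
  Hom A B := ⨁ i, (A.as ⟶ pObj F i B.as)
  id A := oId F A.as
  comp f g := oComp F _ _ _ f g
  id_comp f := oId_comp F f
  comp_id f := oComp_id F f
  assoc f g h := oComp_assoc F f g h

instance orbPreadditive : Preadditive (Orb F) where
  homGroup A B := inferInstanceAs (AddCommGroup (⨁ i, (A.as ⟶ pObj F i B.as)))
  add_comp A B E f f' g :=
    DFunLike.congr_fun ((oComp F A.as B.as E.as).map_add f f') g
  comp_add A B E f g g' := (oComp F A.as B.as E.as f).map_add g g'

/-- The degree zero part. -/
def degZero (A B : C) : (A ⟶ B) →+ ((⟨A⟩ : Orb F) ⟶ ⟨B⟩) :=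
  of (fun i => (A ⟶ pObj F i B)) 0

lemma degZero_comp {A B E : C} (f : A ⟶ B) (g : B ⟶ E) :
    degZero F A E (f ≫ g) = degZero F A B f ≫ degZero F B E g := by
  refine Eq.symm ((oComp_of F (i := 0) (j := 0) f g).trans ?_)
  refine of_congr F (add_zero 0) _ _ ?_
  change (f ≫ g ≫ 𝟙 E) ≫ 𝟙 E = f ≫ g
  simp

lemma degZero_id (A : C) : degZero F A A (𝟙 A) = 𝟙 (⟨A⟩ : Orb F) := rfl

/-- `Ψ_F(X)` is the endomorphism ring of `X` in the orbit category. -/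
def psiEquiv (X : C) : Psi F X ≃+* End (⟨X⟩ : Orb F) where
  toFun a := a
  invFun a := a
  left_inv _ := rfl
  right_inv _ := rfl
  map_add' _ _ := rfl
  map_mul' a b := by
    change a * b = oComp F X X X b a
    induction a using DirectSum.induction_on with
    | zero => simp
    | add f f' hf hf' => simp only [map_add, add_mul, hf, hf']
    | of i f =>
      induction b using DirectSum.induction_on with
      | zero => simp
      | add f f' hf hf' => simp only [map_add, AddMonoidHom.add_apply, mul_add, hf, hf']
      | of j g =>
        rw [oComp_of, DirectSum.of_mul_of]
        rfl

lemma exists_decomp [HasFiniteBiproducts C] (X Y : C)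
    (h : ∃ (m : ℕ) (i : X ⟶ biproduct (fun _ : Fin m => Y))
      (p : biproduct (fun _ : Fin m => Y) ⟶ X), i ≫ p = 𝟙 X) :
    ∃ (m : ℕ) (q : Fin m → ((⟨X⟩ : Orb F) ⟶ ⟨Y⟩)) (p : Fin m → ((⟨Y⟩ : Orb F) ⟶ ⟨X⟩)),
      ∑ k, q k ≫ p k = 𝟙 _ := by
  obtain ⟨m, i, p, h⟩ := h
  refine ⟨m, fun k => degZero F _ _ (i ≫ biproduct.π _ k),
    fun k => degZero F _ _ (biproduct.ι (fun _ : Fin m => Y) k ≫ p), ?_⟩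
  simp only [← degZero_comp]
  rw [← map_sum, ← degZero_id, ← h]
  congr 1
  conv_rhs => rw [← Category.id_comp p, ← biproduct.total (f := fun _ : Fin m => Y)]
  simp only [Preadditive.comp_sum, Preadditive.sum_comp, Category.assoc]

end Orbit

end TotalPreprojective

open TotalPreprojective in
theorem psi_morita_of_add_eq_add
    {C : Type u} [Category.{v} C] [Preadditive C] [HasFiniteBiproducts C]
    (F : C ⥤ C) [F.Additive] (X Y : C)
    (h₁ : ∃ (m : ℕ) (i : X ⟶ biproduct (fun _ : Fin m => Y))
      (p : biproduct (fun _ : Fin m => Y) ⟶ X), i ≫ p = 𝟙 X)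
    (h₂ : ∃ (n : ℕ) (i : Y ⟶ biproduct (fun _ : Fin n => X))
      (p : biproduct (fun _ : Fin n => X) ⟶ Y), i ≫ p = 𝟙 Y) :
    IsMoritaEquivalentRings (Psi F X) (Psi F Y) := by
  obtain ⟨m, q, p, h⟩ := exists_decomp F X Y h₁
  obtain ⟨n, q', p', h'⟩ := exists_decomp F Y X h₂
  exact ⟨(ModuleCat.restrictScalarsEquivalenceOfRingEquiv (psiEquiv F X)).symm.trans
    ((endMorita _ _ q p h q' p' h').trans
      (ModuleCat.restrictScalarsEquivalenceOfRingEquiv (psiEquiv F Y)))⟩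
end
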